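/- For every real r > 1 there exists n_0 such that the following holds for all positive integers k, ℓ, m with n = ℓ(k+m)+1 ≥ n_0: if k ≥ (70/3)·r⁴·log n, ℓ ≥ 210·r⁴·k·log n and m ≥ 18·r²·k, then for every fixed initial mutant x_0 lying in one of the reservoirs R_1∪…∪R_ℓ, the discrete-time Moran process with fitness r on the (k,ℓ,m)-superstar started from the state {x_0} has extinction probability at least 1/(1470·r⁴·k). -/

import Mathlib

open Finset

/-- Total fitness of the mutant set `S` (mutants have fitness `r`, non-mutants fitness `1`). -/
noncomputable def moranW {V : Type*} [Fintype V] (r : ℝ) (S : Finset V) : ℝ :=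
  r * S.card + ((Fintype.card V : ℝ) - S.card)

/-- One-step transition probability of the Moran process with fitness `r` and
reproduction weights `w`, from mutant set `S` to mutant set `T`:  a vertex `u` is chosen
with probability `r / moranW r S` if it is a mutant and `1 / moranW r S` otherwise, then a
target `v` is chosen with probability `w u v`, and `v` becomes a mutant if `u` is one and
a non-mutant otherwise. -/
noncomputable def moranStep {V : Type*} [Fintype V] [DecidableEq V]
    (r : ℝ) (w : V → V → ℝ) (S T : Finset V) : ℝ :=
  ∑ u : V, ∑ v : V,
    ((if u ∈ S then r else 1) / moranW r S) * w u v *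
      (if (if u ∈ S then insert v S else S.erase v) = T then 1 else 0)

/-- Distribution of the Moran process after `t` steps, from initial distribution `init`. -/
noncomputable def moranDist {V : Type*} [Fintype V] [DecidableEq V]
    (r : ℝ) (w : V → V → ℝ) (init : Finset V → ℝ) : ℕ → Finset V → ℝ
  | 0 => init
  | t + 1 => fun T => ∑ S : Finset V, moranDist r w init t S * moranStep r w S T

/-- Reproduction weights of the (unweighted) Moran process on the digraph with
out-neighbourhoods `out`: the offspring goes to a uniformly random out-neighbour. -/
noncomputable def outWeights {V : Type*} [DecidableEq V]
    (out : V → Finset V) : V → V → ℝ :=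
  fun u v => if v ∈ out u then ((out u).card : ℝ)⁻¹ else 0

/-- Extinction probability: `sup_t Pr(S_t = ∅)`. -/
noncomputable def extinctionProb {V : Type*} [Fintype V] [DecidableEq V]
    (r : ℝ) (w : V → V → ℝ) (init : Finset V → ℝ) : ℝ :=
  ⨆ t : ℕ, moranDist r w init t (∅ : Finset V)

/-- Fixation probability: `sup_t Pr(S_t = V)`. -/
noncomputable def fixationProb {V : Type*} [Fintype V] [DecidableEq V]
    (r : ℝ) (w : V → V → ℝ) (init : Finset V → ℝ) : ℝ :=
  ⨆ t : ℕ, moranDist r w init t (Finset.univ : Finset V)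

/-- Initial distribution: a single mutant at a uniformly random vertex. -/
noncomputable def uniformSingleton (V : Type*) [Fintype V] [DecidableEq V] :
    Finset V → ℝ :=
  fun S => if S.card = 1 then (Fintype.card V : ℝ)⁻¹ else 0

/-- Initial distribution: a single mutant at the fixed vertex `x₀`. -/
def pointInit {V : Type*} [DecidableEq V] (x₀ : V) : Finset V → ℝ :=
  fun S => if S = {x₀} then 1 else 0

/-- Vertices of the `(k,ℓ,m)`-superstar: `ℓ` reservoirs `R_i` of size `m`
(`Sum.inl (i, x)`), path vertices `v_{i,j}` for `i ∈ [ℓ]`, `j ∈ [k]`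
(`Sum.inr (Sum.inl (i, j))`), and the centre vertex `v*` (`Sum.inr (Sum.inr ())`).
It has `ℓ * (k + m) + 1` vertices. -/
abbrev SuperstarV (k ℓ m : ℕ) : Type :=
  (Fin ℓ × Fin m) ⊕ ((Fin ℓ × Fin k) ⊕ Unit)

/-- Out-neighbourhoods of the `(k,ℓ,m)`-superstar: the centre points to every reservoir
vertex, each vertex of `R_i` points to `v_{i,1}`, each `v_{i,j}` points to `v_{i,j+1}`
for `j < k`, and `v_{i,k}` points to the centre. -/
def superstarOut (k ℓ m : ℕ) : SuperstarV k ℓ m → Finset (SuperstarV k ℓ m)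
  | Sum.inl (i, _) =>
      if h : 0 < k then {Sum.inr (Sum.inl (i, ⟨0, h⟩))} else {Sum.inr (Sum.inr ())}
  | Sum.inr (Sum.inl (i, j)) =>
      if h : (j : ℕ) + 1 < k then {Sum.inr (Sum.inl (i, ⟨(j : ℕ) + 1, h⟩))}
      else {Sum.inr (Sum.inr ())}
  | Sum.inr (Sum.inr _) =>
      (Finset.univ : Finset (Fin ℓ × Fin m)).image fun p => Sum.inl p

/-! ### General facts about the Moran chain -/
section General

variable {V : Type*} [Fintype V] [DecidableEq V]

/-- State after `u` reproduces onto `v`. -/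
def nextS (S : Finset V) (u v : V) : Finset V := if u ∈ S then insert v S else S.erase v

/-- Fitness of `u`. -/
noncomputable def fit (r : ℝ) (S : Finset V) (u : V) : ℝ := if u ∈ S then r else 1

lemma fit_pos {r : ℝ} (hr : 1 < r) (S : Finset V) (u : V) : 0 < fit r S u := by
  unfold fit; split_ifs <;> linarith

lemma sum_fit (r : ℝ) (S : Finset V) : ∑ u, fit r S u = moranW r S := by
  unfold fit moranW
  have : ∀ u : V, (if u ∈ S then r else 1) = 1 + (if u ∈ S then (r - 1) else 0) := by
    intro u; split_ifs <;> ring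
  simp only [this, Finset.sum_add_distrib, Finset.sum_ite_mem]
  simp
  ring

lemma moranW_pos [Nonempty V] {r : ℝ} (hr : 1 < r) (S : Finset V) : 0 < moranW r S := by
  rw [← sum_fit]
  exact Finset.sum_pos (fun u _ => fit_pos hr S u) Finset.univ_nonempty

lemma step_sum (r : ℝ) (w : V → V → ℝ) (S : Finset V) (f : Finset V → ℝ) :
    ∑ T, moranStep r w S T * f T
      = ∑ u, ∑ v, fit r S u / moranW r S * w u v * f (nextS S u v) := by
  unfold moranStep
  simp only [Finset.sum_mul]
  rw [Finset.sum_comm]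
  refine Finset.sum_congr rfl fun u _ => ?_
  rw [Finset.sum_comm]
  refine Finset.sum_congr rfl fun v _ => ?_
  simp only [mul_ite, mul_one, mul_zero, ite_mul, zero_mul]
  rw [Finset.sum_ite_eq]
  simp [fit, nextS]

lemma step_drift [Nonempty V] {r : ℝ} (hr : 1 < r) (w : V → V → ℝ)
    (hw : ∀ u, ∑ v, w u v = 1) (S : Finset V) (f : Finset V → ℝ) :
    ∑ T, moranStep r w S T * f T - f S
      = (∑ u, fit r S u * ∑ v, w u v * (f (nextS S u v) - f S)) / moranW r S := by
  have hW := (moranW_pos hr S).ne'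
  rw [step_sum]
  have h1 : ∀ u, fit r S u * ∑ v, w u v * (f (nextS S u v) - f S)
      = fit r S u * ∑ v, w u v * f (nextS S u v) - fit r S u * f S := by
    intro u
    simp only [mul_sub, Finset.sum_sub_distrib]
    rw [← Finset.sum_mul, hw u]; ring
  simp only [h1, Finset.sum_sub_distrib]
  rw [← Finset.sum_mul, sum_fit, sub_div, mul_div_assoc, mul_comm (moranW r S),
    div_mul_cancel₀ _ hW, Finset.sum_div]
  congr 1
  refine Finset.sum_congr rfl fun u _ => ?_
  rw [Finset.mul_sum, Finset.sum_div]
  refine Finset.sum_congr rfl fun v _ => ?_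
  ring

lemma step_nonneg [Nonempty V] {r : ℝ} (hr : 1 < r) (w : V → V → ℝ)
    (hw : ∀ u v, 0 ≤ w u v) (S T : Finset V) : 0 ≤ moranStep r w S T := by
  unfold moranStep
  refine Finset.sum_nonneg fun u _ => Finset.sum_nonneg fun v _ => ?_
  have := moranW_pos hr S
  have h2 := hw u v
  have h3 : (0:ℝ) ≤ r := by linarith
  have h4 : (0:ℝ) ≤ if u ∈ S then r else 1 := by split_ifs <;> linarith
  have h5 : ∀ c : Prop, ∀ [Decidable c], (0:ℝ) ≤ if c then 1 else 0 := by
    intro c _; split_ifs <;> norm_num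
  have := h5 ((if u ∈ S then insert v S else S.erase v) = T)
  positivity

lemma dist_nonneg' [Nonempty V] {r : ℝ} (hr : 1 < r) (w : V → V → ℝ)
    (hw : ∀ u v, 0 ≤ w u v) (init : Finset V → ℝ) (hi : ∀ S, 0 ≤ init S) (t : ℕ) :
    ∀ S, 0 ≤ moranDist r w init t S := by
  induction t with
  | zero => exact hi
  | succ t ih =>
    intro S
    exact Finset.sum_nonneg fun T _ => mul_nonneg (ih T) (step_nonneg hr w hw T S)

lemma dist_succ_sum (r : ℝ) (w : V → V → ℝ) (init f : Finset V → ℝ) (t : ℕ) :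
    ∑ T, moranDist r w init (t+1) T * f T
      = ∑ S, moranDist r w init t S * ∑ T, moranStep r w S T * f T := by
  simp only [moranDist, Finset.sum_mul, Finset.mul_sum]
  rw [Finset.sum_comm]
  refine Finset.sum_congr rfl fun _ _ => Finset.sum_congr rfl fun _ _ => by ring

lemma dist_sum [Nonempty V] {r : ℝ} (hr : 1 < r) (w : V → V → ℝ)
    (hw1 : ∀ u, ∑ v, w u v = 1) (init : Finset V → ℝ) (hi : ∑ S, init S = 1) (t : ℕ) :
    ∑ S, moranDist r w init t S = 1 := by
  induction t with
  | zero => exact hi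
  | succ t ih =>
    have h := dist_succ_sum r w init (fun _ => 1) t
    have h2 : ∀ S, ∑ T, moranStep r w S T * (fun _ => (1:ℝ)) T = 1 := by
      intro S
      have := step_drift hr w hw1 S (fun _ => 1)
      simp only [sub_self, mul_zero, Finset.sum_const_zero, zero_div] at this
      linarith
    simp only [h2] at h
    simpa [ih] using h

/-- Submartingale criterion for a lower bound on the extinction probability. -/
lemma extinction_ge [Nonempty V] {r : ℝ} (hr : 1 < r) (w : V → V → ℝ)
    (hw : ∀ u v, 0 ≤ w u v) (hw1 : ∀ u, ∑ v, w u v = 1) (x : V) (f : Finset V → ℝ)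
    (hf0 : ∀ S, 0 ≤ f S) (hf1 : ∀ S, f S ≤ 1)
    (hd : ∀ S, S ≠ ∅ → f S ≠ 0 → 
      0 < ∑ u, fit r S u * ∑ v, w u v * (f (nextS S u v) - f S)) :
    f {x} ≤ extinctionProb r w (pointInit x) := by
  set d := moranDist r w (pointInit x) with hdd
  have hi0 : ∀ S : Finset V, 0 ≤ pointInit x S := by
    intro S; unfold pointInit; split_ifs <;> norm_num
  have hi1 : ∑ S : Finset V, pointInit x S = 1 := by simp [pointInit]
  have dn : ∀ t S, 0 ≤ d t S := dist_nonneg' hr w hw _ hi0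
  have d1 : ∀ t, ∑ S, d t S = 1 := dist_sum hr w hw1 _ hi1
  have dle : ∀ t S, d t S ≤ 1 := by
    intro t S
    rw [← d1 t]
    exact Finset.single_le_sum (fun T _ => dn t T) (Finset.mem_univ S)
  have bdd : BddAbove (Set.range fun t => d t ∅) := ⟨1, by rintro _ ⟨t, rfl⟩; exact dle t ∅⟩
  -- the good nonempty states
  set G : Finset (Finset V) := Finset.univ.filter (fun S => S ≠ ∅ ∧ f S ≠ 0) with hG
  set dr : Finset V → ℝ := fun S => ∑ T, moranStep r w S T * f T - f S with hdr
  have drG : ∀ S ∈ G, 0 < dr S := by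
    intro S hS
    simp only [hG, Finset.mem_filter, Finset.mem_univ, true_and] at hS
    simp only [hdr]
    rw [step_drift hr w hw1]
    exact div_pos (hd S hS.1 hS.2) (moranW_pos hr S)
  obtain ⟨δ, hδ, hδG⟩ : ∃ δ > 0, ∀ S ∈ G, δ ≤ dr S := by
    rcases G.eq_empty_or_nonempty with h | h
    · exact ⟨1, one_pos, by simp [h]⟩
    · obtain ⟨S, hS, hm⟩ := Finset.exists_min_image G dr h
      exact ⟨dr S, drG S hS, hm⟩
  have dr0 : ∀ S, 0 ≤ dr S := by
    intro S
    by_cases hS : S ∈ G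
    · exact (drG S hS).le
    · simp only [hG, Finset.mem_filter, Finset.mem_univ, true_and, not_and, not_not] at hS
      simp only [hdr]
      by_cases hE : S = ∅
      · rw [step_drift hr w hw1]
        simp [hE, nextS]
      · rw [hS hE, sub_zero]
        exact Finset.sum_nonneg fun T _ => mul_nonneg (step_nonneg hr w hw _ _) (hf0 T)
  set E : ℕ → ℝ := fun t => ∑ S, d t S * f S with hE
  set g : ℕ → ℝ := fun t => ∑ S ∈ G, d t S with hg
  have gn : ∀ t, 0 ≤ g t := fun t => Finset.sum_nonneg fun S _ => dn t S
  have Estep : ∀ t, E t + δ * g t ≤ E (t+1) := by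
    intro t
    have h := dist_succ_sum r w (pointInit x) f t
    have h1 : E (t+1) = ∑ S, d t S * (f S + dr S) := by
      simp only [hE]; rw [h]
      refine Finset.sum_congr rfl fun S _ => ?_
      simp [hdr]
      left; rfl
    rw [h1]
    simp only [mul_add, Finset.sum_add_distrib]
    have : δ * g t ≤ ∑ S, d t S * dr S := by
      calc δ * g t = ∑ S ∈ G, d t S * δ := by simp [hg, Finset.mul_sum, mul_comm]
        _ ≤ ∑ S ∈ G, d t S * dr S :=
          Finset.sum_le_sum fun S hS => mul_le_mul_of_nonneg_left (hδG S hS) (dn t S)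
        _ ≤ ∑ S, d t S * dr S :=
          Finset.sum_le_sum_of_subset_of_nonneg (Finset.subset_univ _)
            (fun S _ _ => mul_nonneg (dn t S) (dr0 S))
    linarith
  have E0 : E 0 = f {x} := by
    simp [hE, hdd, moranDist, pointInit]
  have Ele : ∀ t, E t ≤ 1 := by
    intro t
    rw [← d1 t]
    exact Finset.sum_le_sum fun S _ => mul_le_of_le_one_right (dn t S) (hf1 S)
  have Emono : ∀ t, f {x} ≤ E t := by
    intro t
    induction t with
    | zero => exact E0.ge
    | succ t ih => have := Estep t; have := mul_nonneg hδ.le (gn t); linarith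
  have Esplit : ∀ t, E t ≤ d t ∅ + g t := by
    intro t
    have : ∀ S, d t S * f S ≤ (if S = ∅ then d t S else 0) + (if S ∈ G then d t S else 0) := by
      intro S
      have a1 := dn t S
      have a2 := mul_le_of_le_one_right (dn t S) (hf1 S)
      by_cases h1 : S = ∅
      · rw [if_pos h1]; split_ifs <;> linarith
      · by_cases h2 : f S = 0
        · rw [h2, mul_zero]; split_ifs <;> linarith
        · have : S ∈ G := by simp [hG, h1, h2]
          rw [if_neg h1, if_pos this]; linarith
    refine (Finset.sum_le_sum fun S _ => this S).trans ?_
    rw [Finset.sum_add_distrib]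
    simp [hg]
  have key : ∀ ε > 0, ∃ t, g t < ε := by
    intro ε hε
    by_contra hcon
    push Not at hcon
    have : ∀ t : ℕ, f {x} + t * (δ * ε) ≤ E t := by
      intro t
      induction t with
      | zero => simp [E0]
      | succ t ih =>
        have h1 := Estep t
        have h2 := mul_le_mul_of_nonneg_left (hcon t) hδ.le
        push_cast; linarith
    obtain ⟨N, hN⟩ := exists_nat_gt (1 / (δ * ε))
    have h3 := this N
    have h4 := Ele N
    have h5 := hf0 {x}
    rw [div_lt_iff₀ (by positivity)] at hN
    linarith
  refine le_of_forall_pos_le_add fun ε hε => ?_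
  obtain ⟨t, ht⟩ := key ε hε
  have h1 := Emono t
  have h2 := Esplit t
  have h3 : d t ∅ ≤ extinctionProb r w (pointInit x) := le_ciSup bdd t
  linarith

lemma outWeights_nonneg (out : V → Finset V) (u v : V) : 0 ≤ outWeights out u v := by
  unfold outWeights; split_ifs <;> positivity

lemma outWeights_sum_mul (out : V → Finset V) (u : V) (F : V → ℝ) :
    ∑ v, outWeights out u v * F v = ((out u).card : ℝ)⁻¹ * ∑ v ∈ out u, F v := by
  unfold outWeights
  simp only [ite_mul, zero_mul, Finset.sum_ite_mem, Finset.univ_inter, Finset.mul_sum]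

lemma outWeights_sum (out : V → Finset V) (h : ∀ u, (out u).Nonempty) (u : V) :
    ∑ v, outWeights out u v = 1 := by
  have := outWeights_sum_mul out u (fun _ => 1)
  simp only [mul_one, Finset.sum_const, nsmul_eq_mul] at this
  rw [this]
  exact inv_mul_cancel₀ (by have := (h u).card_pos; positivity)

lemma outWeights_single (out : V → Finset V) (u t : V) (h : out u = {t}) (F : V → ℝ) :
    ∑ v, outWeights out u v * F v = F t := by
  rw [outWeights_sum_mul, h]; simp

end General
/-! ### The superstar -/
section Superstar

variable {k ℓ m : ℕ}

/-- Reservoir vertex. -/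
abbrev rv (i : Fin ℓ) (x : Fin m) : SuperstarV k ℓ m := Sum.inl (i, x)
/-- Path vertex. -/
abbrev pv (i : Fin ℓ) (j : Fin k) : SuperstarV k ℓ m := Sum.inr (Sum.inl (i, j))
/-- Centre. -/
abbrev cv : SuperstarV k ℓ m := Sum.inr (Sum.inr ())

/-- No mutants outside `x₀`, its own path and the centre. -/
def GoodS (i0 : Fin ℓ) (x0 : Fin m) (S : Finset (SuperstarV k ℓ m)) : Prop :=
  (∀ i x, rv i x ∈ S → i = i0 ∧ x = x0) ∧ (∀ i j, pv i j ∈ S → i = i0)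

/-- Distance of the rear mutant (ignoring the first path vertex) from the end of the path. -/
def g2 (i0 : Fin ℓ) (S : Finset (SuperstarV k ℓ m)) : ℕ :=
  (Finset.univ.filter (fun j : Fin k => 0 < (j : ℕ) ∧ pv i0 j ∈ S)).sup (fun j => k - (j : ℕ))

/-- Potential. -/
noncomputable def phi (hk : 0 < k) (i0 : Fin ℓ) (β γ a : ℝ) (S : Finset (SuperstarV k ℓ m)) : ℝ :=
  (if cv ∈ S then β else 0) + γ * ((if pv i0 ⟨0, hk⟩ ∈ S then a else 0) + g2 i0 S)

/-- Weight of `x₀`. -/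
noncomputable def qq (i0 : Fin ℓ) (x0 : Fin m) (p : ℝ) (S : Finset (SuperstarV k ℓ m)) : ℝ :=
  if rv i0 x0 ∈ S then p else 1

open Classical in
/-- The submartingale. -/
noncomputable def ff (hk : 0 < k) (i0 : Fin ℓ) (x0 : Fin m) (β γ a p : ℝ)
    (S : Finset (SuperstarV k ℓ m)) : ℝ :=
  if GoodS i0 x0 S then qq i0 x0 p S * (1 - phi hk i0 β γ a S) else 0

lemma g2_mono (i0 : Fin ℓ) {S T : Finset (SuperstarV k ℓ m)} (h : S ⊆ T) :
    g2 i0 S ≤ g2 i0 T := by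
  unfold g2
  apply Finset.sup_mono
  intro j
  simp only [Finset.mem_filter, Finset.mem_univ, true_and]
  exact fun hj => ⟨hj.1, h hj.2⟩

lemma g2_le (i0 : Fin ℓ) (S : Finset (SuperstarV k ℓ m)) : g2 i0 S ≤ k - 1 := by
  unfold g2
  apply Finset.sup_le
  intro j
  simp only [Finset.mem_filter, Finset.mem_univ, true_and]
  omega

lemma le_g2 (i0 : Fin ℓ) (S : Finset (SuperstarV k ℓ m)) (j : Fin k) (hj : 0 < (j : ℕ))
    (h : pv i0 j ∈ S) : k - (j : ℕ) ≤ g2 i0 S := by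
  unfold g2
  exact Finset.le_sup (f := fun j : Fin k => k - (j : ℕ)) (by simp [hj, h])

lemma g2_congr (i0 : Fin ℓ) {S T : Finset (SuperstarV k ℓ m)}
    (h : ∀ j : Fin k, 0 < (j : ℕ) → (pv i0 j ∈ S ↔ pv i0 j ∈ T)) : g2 i0 S = g2 i0 T := by
  unfold g2
  congr 1
  ext j
  simp only [Finset.mem_filter, Finset.mem_univ, true_and]
  exact and_congr_right (h j)

lemma g2_rear (hk : 0 < k) (i0 : Fin ℓ) (S : Finset (SuperstarV k ℓ m)) (h : 0 < g2 i0 S)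
    (h0 : pv i0 ⟨0, hk⟩ ∉ S) :
    ∃ j : Fin k, ∃ hj : (j : ℕ) + 1 < k, pv i0 j ∉ S ∧
      g2 i0 (S.erase (pv i0 ⟨(j : ℕ) + 1, hj⟩)) + 1 ≤ g2 i0 S := by
  have hne : (Finset.univ.filter (fun j : Fin k => 0 < (j : ℕ) ∧ pv i0 j ∈ S)).Nonempty := by
    rw [Finset.nonempty_iff_ne_empty]
    intro he
    unfold g2 at h
    rw [he] at h
    simp at h
  obtain ⟨j, hj, hm⟩ := Finset.exists_mem_eq_sup _ hne (fun j : Fin k => k - (j : ℕ))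
  simp only [Finset.mem_filter, Finset.mem_univ, true_and] at hj
  have hm' : g2 i0 S = k - (j : ℕ) := hm
  have hjk := j.isLt
  refine ⟨⟨(j : ℕ) - 1, by omega⟩, by simp only; omega, ?_, ?_⟩
  · intro hin
    by_cases hj1 : (j : ℕ) = 1
    · apply h0
      convert hin using 5
      omega
    · have := le_g2 i0 S ⟨(j : ℕ) - 1, by omega⟩ (by simp only; omega) hin
      simp only at this
      omega
  · have e : (⟨(j : ℕ) - 1 + 1, by omega⟩ : Fin k) = j := by ext; simp only; omega
    simp only [e]
    rw [hm']
    have : g2 i0 (S.erase (pv i0 j)) ≤ k - (j : ℕ) - 1 := by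
      unfold g2
      apply Finset.sup_le
      intro b
      simp only [Finset.mem_filter, Finset.mem_univ, true_and]
      rintro ⟨hb0, hb⟩
      have hbS := Finset.mem_of_mem_erase hb
      have hne : b ≠ j := by
        rintro rfl
        exact (Finset.notMem_erase _ _) hb
      have h1 := le_g2 i0 S b hb0 hbS
      have hbk := b.isLt
      have : (b : ℕ) ≠ j := fun h => hne (Fin.ext h)
      omega
    omega

section params

variable (hk : 0 < k) (i0 : Fin ℓ) (x0 : Fin m) {r β γ a p : ℝ}

lemma phi_nonneg (hβ : 0 < β) (hγ : 0 < γ) (ha : 0 < a) (S : Finset (SuperstarV k ℓ m)) :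
    0 ≤ phi hk i0 β γ a S := by
  unfold phi
  split_ifs <;> positivity

lemma phi_le (hβ : 0 < β) (hγ : 0 < γ) (ha : 0 < a) (S : Finset (SuperstarV k ℓ m)) :
    phi hk i0 β γ a S ≤ β + γ * (a + k) := by
  unfold phi
  have h : (g2 i0 S : ℝ) ≤ k := by exact_mod_cast (g2_le i0 S).trans (Nat.sub_le _ _)
  have h1 : (if (cv : SuperstarV k ℓ m) ∈ S then β else 0) ≤ β := by
    split_ifs <;> linarith
  have h2 : (if (pv i0 ⟨0, hk⟩ : SuperstarV k ℓ m) ∈ S then a else 0) ≤ a := by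
    split_ifs <;> linarith
  gcongr

lemma phi_erase (hβ : 0 < β) (hγ : 0 < γ) (ha : 0 < a) (S : Finset (SuperstarV k ℓ m))
    (t : SuperstarV k ℓ m) : phi hk i0 β γ a (S.erase t) ≤ phi hk i0 β γ a S := by
  unfold phi
  have h : (g2 i0 (S.erase t) : ℝ) ≤ g2 i0 S := by
    exact_mod_cast g2_mono i0 (Finset.erase_subset t S)
  have h3 : ∀ (b : ℝ) (_ : 0 < b) (v : SuperstarV k ℓ m),
      (if v ∈ S.erase t then b else 0) ≤ if v ∈ S then b else 0 := by
    intro b hb v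
    by_cases hv : v ∈ S.erase t
    · rw [if_pos hv, if_pos (Finset.mem_of_mem_erase hv)]
    · rw [if_neg hv]; split_ifs <;> linarith
  have h1 := h3 β hβ cv
  have h2 := h3 a ha (pv i0 ⟨0, hk⟩)
  gcongr

lemma phi_erase_cv (S : Finset (SuperstarV k ℓ m)) :
    phi hk i0 β γ a S = phi hk i0 β γ a (S.erase cv) + if cv ∈ S then β else 0 := by
  unfold phi
  rw [g2_congr i0 (S := S.erase cv) (T := S) (by intro j _; simp)]
  simp
  ring

lemma phi_insert_cv (hβ : 0 < β) (S : Finset (SuperstarV k ℓ m)) :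
    phi hk i0 β γ a (insert cv S) ≤ phi hk i0 β γ a S + β := by
  unfold phi
  rw [g2_congr i0 (S := insert cv S) (T := S) (by intro j _; simp)]
  simp
  split_ifs <;> linarith

lemma phi_erase_first (S : Finset (SuperstarV k ℓ m)) :
    phi hk i0 β γ a S = phi hk i0 β γ a (S.erase (pv i0 ⟨0, hk⟩))
      + if pv i0 ⟨0, hk⟩ ∈ S then γ * a else 0 := by
  unfold phi
  rw [g2_congr i0 (S := S.erase (pv i0 ⟨0, hk⟩)) (T := S) (by
    intro j hj
    have : j ≠ ⟨0, hk⟩ := by rintro rfl; simp at hj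
    simp [this])]
  simp
  split_ifs <;> ring

lemma phi_insert_first (hγ : 0 < γ) (ha : 0 < a) (S : Finset (SuperstarV k ℓ m)) :
    phi hk i0 β γ a (insert (pv i0 ⟨0, hk⟩) S) ≤ phi hk i0 β γ a S + γ * a := by
  unfold phi
  rw [g2_congr i0 (S := insert (pv i0 ⟨0, hk⟩) S) (T := S) (by
    intro j hj
    have : j ≠ ⟨0, hk⟩ := by rintro rfl; simp at hj
    simp [this])]
  simp
  have := mul_pos hγ ha
  split_ifs <;> nlinarith

lemma phi_insert_path (hγ : 0 < γ) (S : Finset (SuperstarV k ℓ m))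
    (j : Fin k) (hj : (j : ℕ) + 1 < k) (hjS : pv i0 j ∈ S) :
    phi hk i0 β γ a (insert (pv i0 ⟨(j : ℕ) + 1, hj⟩) S) ≤ phi hk i0 β γ a S
      + if (j : ℕ) = 0 then γ * ((k : ℝ) - 1) else 0 := by
  unfold phi
  have e1 : (pv i0 ⟨0, hk⟩ ∈ insert (pv i0 ⟨(j : ℕ) + 1, hj⟩) S) ↔ pv i0 ⟨0, hk⟩ ∈ S := by simp
  have e2 : (cv ∈ insert (pv i0 ⟨(j : ℕ) + 1, hj⟩) S) ↔ cv ∈ S := by simp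
  simp only [e1, e2]
  have h : (g2 i0 (insert (pv i0 ⟨(j : ℕ) + 1, hj⟩) S) : ℝ) ≤ g2 i0 S
      + if (j : ℕ) = 0 then ((k : ℝ) - 1) else 0 := by
    split_ifs with h0
    · have := g2_le i0 (insert (pv i0 ⟨(j : ℕ) + 1, hj⟩) S)
      have h2 : (g2 i0 (insert (pv i0 ⟨(j : ℕ) + 1, hj⟩) S) : ℝ) + 1 ≤ k := by
        exact_mod_cast (by omega)
      have : (0:ℝ) ≤ g2 i0 S := by positivity
      linarith
    · rw [add_zero]
      norm_cast
      conv_lhs => unfold g2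
      apply Finset.sup_le
      intro b
      simp only [Finset.mem_filter, Finset.mem_univ, true_and, Finset.mem_insert]
      rintro ⟨hb0, hb | hb⟩
      · have hb' : b = ⟨(j : ℕ) + 1, hj⟩ := by simpa using hb
        have := le_g2 i0 S j (by omega) hjS
        rw [hb']
        simp only
        omega
      · exact le_g2 i0 S b hb0 hb
  have h2 := mul_le_mul_of_nonneg_left h hγ.le
  rw [mul_add γ (g2 i0 S : ℝ)] at h2
  have e3 : γ * (if (j : ℕ) = 0 then ((k : ℝ) - 1) else 0)
    = if (j : ℕ) = 0 then γ * ((k : ℝ) - 1) else 0 := by split_ifs <;> simp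
  rw [e3] at h2
  linarith

lemma phi_erase_rear (hγ : 0 < γ) (S : Finset (SuperstarV k ℓ m))
    (j : Fin k) (hj : (j : ℕ) + 1 < k)
    (h : g2 i0 (S.erase (pv i0 ⟨(j : ℕ) + 1, hj⟩)) + 1 ≤ g2 i0 S) :
    phi hk i0 β γ a (S.erase (pv i0 ⟨(j : ℕ) + 1, hj⟩)) + γ ≤ phi hk i0 β γ a S := by
  unfold phi
  have e1 : (pv i0 ⟨0, hk⟩ ∈ S.erase (pv i0 ⟨(j : ℕ) + 1, hj⟩)) ↔ pv i0 ⟨0, hk⟩ ∈ S := by simp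
  have e2 : (cv ∈ S.erase (pv i0 ⟨(j : ℕ) + 1, hj⟩)) ↔ cv ∈ S := by simp
  simp only [e1, e2]
  have : (g2 i0 (S.erase (pv i0 ⟨(j : ℕ) + 1, hj⟩)) : ℝ) + 1 ≤ g2 i0 S := by exact_mod_cast h
  have := mul_le_mul_of_nonneg_left this hγ.le
  linarith

lemma good_erase {S : Finset (SuperstarV k ℓ m)} (h : GoodS i0 x0 S) (t) :
    GoodS i0 x0 (S.erase t) :=
  ⟨fun i x hi => h.1 i x (Finset.mem_of_mem_erase hi),
    fun i j hi => h.2 i j (Finset.mem_of_mem_erase hi)⟩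

lemma good_insert_pv {S : Finset (SuperstarV k ℓ m)} (h : GoodS i0 x0 S) (j) :
    GoodS i0 x0 (insert (pv i0 j) S) := by
  refine ⟨fun i x hi => h.1 i x (by simpa using hi), fun i j' hi => ?_⟩
  rw [Finset.mem_insert] at hi
  rcases hi with hi | hi
  · simp at hi; exact hi.1
  · exact h.2 i j' hi

lemma good_insert_cv {S : Finset (SuperstarV k ℓ m)} (h : GoodS i0 x0 S) :
    GoodS i0 x0 (insert cv S) :=
  ⟨fun i x hi => h.1 i x (by simpa using hi), fun i j hi => h.2 i j (by simpa using hi)⟩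

/-- Change of `ff` between good states with same status of `x₀`. -/
lemma ff_diff {S T : Finset (SuperstarV k ℓ m)} (h : GoodS i0 x0 S) (h' : GoodS i0 x0 T)
    (hx : rv i0 x0 ∈ T ↔ rv i0 x0 ∈ S) :
    ff hk i0 x0 β γ a p T - ff hk i0 x0 β γ a p S
      = qq i0 x0 p S * (phi hk i0 β γ a S - phi hk i0 β γ a T) := by
  unfold ff
  rw [if_pos h, if_pos h']
  have : qq i0 x0 p T = qq i0 x0 p S := by unfold qq; simp only [hx]
  rw [this]; ring

lemma out_rv (i : Fin ℓ) (x : Fin m) :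
    superstarOut k ℓ m (rv i x) = {pv i ⟨0, hk⟩} := by
  simp [superstarOut, hk]

lemma out_pv (i : Fin ℓ) (j : Fin k) (hj : (j : ℕ) + 1 < k) :
    superstarOut k ℓ m (pv i j) = {pv i ⟨(j : ℕ) + 1, hj⟩} := by
  simp [superstarOut, hj]

lemma out_pv_last (i : Fin ℓ) (j : Fin k) (hj : ¬ (j : ℕ) + 1 < k) :
    superstarOut k ℓ m (pv i j) = {cv} := by
  simp [superstarOut, hj]

lemma out_cv : superstarOut k ℓ m cv
    = (Finset.univ : Finset (Fin ℓ × Fin m)).image fun p => Sum.inl p := by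
  simp [superstarOut]

lemma qq_nonneg (hp : 0 < p) (S : Finset (SuperstarV k ℓ m)) : 0 < qq i0 x0 p S := by
  unfold qq; split_ifs <;> linarith

lemma drift_rv (hr : 1 < r) (hβ : 0 < β) (hγ : 0 < γ) (ha : 0 < a) (hp : 0 < p)
    {S : Finset (SuperstarV k ℓ m)} (hS : GoodS i0 x0 S) (i : Fin ℓ) (x : Fin m) :
    qq i0 x0 p S * (if i = i0 then ((if pv i0 ⟨0, hk⟩ ∈ S then γ * a else 0) +
        (if x = x0 then -((if rv i0 x0 ∈ S then r * (γ * a) else 0) +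
          (if pv i0 ⟨0, hk⟩ ∈ S then γ * a else 0)) else 0)) else 0)
      ≤ fit r S (rv i x) * ∑ v, outWeights (superstarOut k ℓ m) (rv i x) v *
        (ff hk i0 x0 β γ a p (nextS S (rv i x) v) - ff hk i0 x0 β γ a p S) := by
  have hq := qq_nonneg i0 x0 hp S
  rw [outWeights_single _ _ _ (out_rv hk i x)]
  by_cases hm : rv i x ∈ S
  · obtain ⟨rfl, rfl⟩ := hS.1 i x hm
    simp only [nextS, fit, hm, if_true]
    rw [ff_diff hk i x hS (good_insert_pv i x hS _) (by simp)]
    have := phi_insert_first (β := β) hk i hγ ha S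
    rw [mul_left_comm r (qq _ _ _ _)]
    apply mul_le_mul_of_nonneg_left _ hq.le
    nlinarith
  · simp only [nextS, fit, hm, if_false]
    rw [ff_diff hk i0 x0 hS (good_erase i0 x0 hS _) (by simp), one_mul]
    apply mul_le_mul_of_nonneg_left _ hq.le
    have h1 := phi_erase hk i0 hβ hγ ha S (pv i ⟨0, hk⟩)
    by_cases hi : i = i0
    · subst hi
      have h2 := phi_erase_first (β := β) (γ := γ) (a := a) hk i S
      have := mul_pos hγ ha
      by_cases hx : x = x0
      · subst hx
        simp only [hm, if_true, if_false]
        linarith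
      · simp only [hx, if_true, if_false]
        linarith
    · simp only [hi, if_false]; linarith

lemma drift_pv_other (hr : 1 < r) (hβ : 0 < β) (hγ : 0 < γ) (ha : 0 < a) (hp : 0 < p)
    {S : Finset (SuperstarV k ℓ m)} (hS : GoodS i0 x0 S) (i : Fin ℓ) (hi : i ≠ i0) (j : Fin k) :
    qq i0 x0 p S * (if j = ⟨k - 1, by omega⟩ then (if cv ∈ S then β else 0) else 0)
      ≤ fit r S (pv i j) * ∑ v, outWeights (superstarOut k ℓ m) (pv i j) v *
        (ff hk i0 x0 β γ a p (nextS S (pv i j) v) - ff hk i0 x0 β γ a p S) := by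
  have hq := qq_nonneg i0 x0 hp S
  have hm : pv i j ∉ S := fun h => hi (hS.2 i j h)
  simp only [nextS, fit, hm, if_false, one_mul]
  by_cases hj : (j : ℕ) + 1 < k
  · rw [outWeights_single _ _ _ (out_pv i j hj)]
    rw [ff_diff hk i0 x0 hS (good_erase i0 x0 hS _) (by simp)]
    apply mul_le_mul_of_nonneg_left _ hq.le
    have h1 := phi_erase hk i0 hβ hγ ha S (pv i ⟨(j : ℕ) + 1, hj⟩)
    have : j ≠ ⟨k - 1, by omega⟩ := by
      intro h; have := congrArg Fin.val h; simp only at this; omega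
    simp only [this, if_false]
    linarith
  · rw [outWeights_single _ _ _ (out_pv_last i j hj)]
    rw [ff_diff hk i0 x0 hS (good_erase i0 x0 hS _) (by simp)]
    apply mul_le_mul_of_nonneg_left _ hq.le
    have h1 := phi_erase_cv (β := β) (γ := γ) (a := a) hk i0 S
    have : j = ⟨k - 1, by omega⟩ := by ext; simp only; omega
    rw [if_pos this]
    linarith

lemma drift_pv_own (hr : 1 < r) (hβ : 0 < β) (hγ : 0 < γ) (ha : 0 < a) (hp : 0 < p)
    {S : Finset (SuperstarV k ℓ m)} (hS : GoodS i0 x0 S) :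
    ∃ js : Fin k, ∀ j : Fin k,
    qq i0 x0 p S * (-(if j = ⟨0, hk⟩ then
          (if pv i0 ⟨0, hk⟩ ∈ S then r * (γ * ((k : ℝ) - 1)) else 0) else 0)
        - (if j = ⟨k - 1, by omega⟩ then
          (if pv i0 ⟨k - 1, by omega⟩ ∈ S then r * β else 0) else 0)
        + (if j = js then (if pv i0 ⟨0, hk⟩ ∉ S ∧ 0 < g2 i0 S then γ else 0) else 0))
      ≤ fit r S (pv i0 j) * ∑ v, outWeights (superstarOut k ℓ m) (pv i0 j) v *
        (ff hk i0 x0 β γ a p (nextS S (pv i0 j) v) - ff hk i0 x0 β γ a p S) := by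
  have hq := qq_nonneg i0 x0 hp S
  have hk1 : (0:ℝ) ≤ (k : ℝ) - 1 := by
    have : (1:ℝ) ≤ k := by exact_mod_cast hk
    linarith
  obtain ⟨js, hjs⟩ : ∃ js : Fin k, (pv i0 ⟨0, hk⟩ ∉ S ∧ 0 < g2 i0 S) →
      ∃ hj : (js : ℕ) + 1 < k, pv i0 js ∉ S ∧
      g2 i0 (S.erase (pv i0 ⟨(js : ℕ) + 1, hj⟩)) + 1 ≤ g2 i0 S := by
    by_cases h : pv i0 ⟨0, hk⟩ ∉ S ∧ 0 < g2 i0 S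
    · obtain ⟨j, hj⟩ := g2_rear hk i0 S h.2 h.1
      exact ⟨j, fun _ => hj⟩
    · exact ⟨⟨0, hk⟩, fun h' => absurd h' h⟩
  refine ⟨js, fun j => ?_⟩
  set P := (pv i0 ⟨0, hk⟩ ∉ S ∧ 0 < g2 i0 S) with hP
  have hA1 : (0:ℝ) ≤ if j = ⟨0, hk⟩ then
          (if pv i0 ⟨0, hk⟩ ∈ S then r * (γ * ((k : ℝ) - 1)) else 0) else 0 := by
    split_ifs <;> positivity
  have hA2 : (0:ℝ) ≤ if j = ⟨k - 1, by omega⟩ then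
          (if pv i0 ⟨k - 1, by omega⟩ ∈ S then r * β else 0) else 0 := by
    split_ifs <;> positivity
  by_cases hm : pv i0 j ∈ S
  · simp only [nextS, fit, hm, if_true]
    have hA3 : (if j = js then (if P then γ else 0) else 0) = 0 := by
      split_ifs with h1 h2
      · obtain ⟨_, h3, _⟩ := hjs h2
        exact absurd (h1 ▸ hm) h3
      · rfl
      · rfl
    rw [hA3]
    by_cases hj : (j : ℕ) + 1 < k
    · rw [outWeights_single _ _ _ (out_pv i0 j hj)]
      rw [ff_diff hk i0 x0 hS (good_insert_pv i0 x0 hS _) (by simp), mul_left_comm r (qq _ _ _ _)]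
      apply mul_le_mul_of_nonneg_left _ hq.le
      have h1 := phi_insert_path (β := β) (a := a) hk i0 hγ S j hj hm
      by_cases h0 : (j : ℕ) = 0
      · have h0' : j = ⟨0, hk⟩ := Fin.ext h0
        rw [if_pos h0] at h1
        have h3 : pv i0 ⟨0, hk⟩ ∈ S := h0' ▸ hm
        rw [if_pos h0', if_pos h3]
        nlinarith
      · rw [if_neg h0] at h1
        nlinarith
    · rw [outWeights_single _ _ _ (out_pv_last i0 j hj)]
      rw [ff_diff hk i0 x0 hS (good_insert_cv i0 x0 hS) (by simp), mul_left_comm r (qq _ _ _ _)]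
      apply mul_le_mul_of_nonneg_left _ hq.le
      have h1 := phi_insert_cv (γ := γ) (a := a) hk i0 hβ S
      have h2 : j = ⟨k - 1, by omega⟩ := by ext; simp only; omega
      have h3 : pv i0 ⟨k - 1, by omega⟩ ∈ S := h2 ▸ hm
      rw [if_pos h2, if_pos h3]
      nlinarith
  · simp only [nextS, fit, hm, if_false, one_mul]
    by_cases hj : (j : ℕ) + 1 < k
    · rw [outWeights_single _ _ _ (out_pv i0 j hj)]
      rw [ff_diff hk i0 x0 hS (good_erase i0 x0 hS _) (by simp)]
      apply mul_le_mul_of_nonneg_left _ hq.le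
      have h1 := phi_erase hk i0 hβ hγ ha S (pv i0 ⟨(j : ℕ) + 1, hj⟩)
      by_cases hjj : j = js
      · subst hjj
        by_cases hPP : P
        · obtain ⟨_, _, h4⟩ := hjs hPP
          have := phi_erase_rear (β := β) (a := a) hk i0 hγ S j hj h4
          rw [if_pos rfl, if_pos hPP]
          linarith
        · rw [if_pos rfl, if_neg hPP]; linarith
      · rw [if_neg hjj]; linarith
    · rw [outWeights_single _ _ _ (out_pv_last i0 j hj)]
      rw [ff_diff hk i0 x0 hS (good_erase i0 x0 hS _) (by simp)]
      apply mul_le_mul_of_nonneg_left _ hq.le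
      have h1 := phi_erase hk i0 hβ hγ ha S cv
      have hA3 : (if j = js then (if P then γ else 0) else 0) = 0 := by
        split_ifs with h1 h2
        · obtain ⟨h3, _, _⟩ := hjs h2
          exact absurd (h1 ▸ h3) hj
        · rfl
        · rfl
      rw [hA3]; linarith

lemma ff_nonneg (hβ : 0 < β) (hγ : 0 < γ) (ha : 0 < a) (hp : 0 < p)
    (hphi : β + γ * (a + k) ≤ 1 / 2) (S : Finset (SuperstarV k ℓ m)) :
    0 ≤ ff hk i0 x0 β γ a p S := by
  unfold ff
  split_ifs
  · have := phi_le hk i0 hβ hγ ha S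
    exact mul_nonneg (qq_nonneg i0 x0 hp S).le (by linarith)
  · exact le_rfl

lemma ff_le_qq (hβ : 0 < β) (hγ : 0 < γ) (ha : 0 < a) (hp : 0 < p)
    (S : Finset (SuperstarV k ℓ m)) :
    ff hk i0 x0 β γ a p S ≤ qq i0 x0 p S := by
  unfold ff
  have hq := (qq_nonneg i0 x0 hp S).le
  split_ifs
  · have := phi_nonneg hk i0 hβ hγ ha S
    exact mul_le_of_le_one_right hq (by linarith)
  · exact hq

lemma out_nonempty {k ℓ m : ℕ} (hk : 0 < k) (i0 : Fin ℓ) (x0 : Fin m) (u : SuperstarV k ℓ m) :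
    (superstarOut k ℓ m u).Nonempty := by
  rcases u with ⟨i, x⟩ | ⟨i, j⟩ | ⟨⟩
  · rw [out_rv hk]; simp
  · by_cases hj : (j : ℕ) + 1 < k
    · rw [out_pv i j hj]; simp
    · rw [out_pv_last i j hj]; simp
  · rw [out_cv]
    exact ⟨Sum.inl (i0, x0), by simp⟩

lemma drift_cv (hr : 1 < r) (hβ : 0 < β) (hγ : 0 < γ) (ha : 0 < a) (hp : 0 < p) (hp1 : p < 1)
    (hphi : β + γ * (a + k) ≤ 1 / 2)
    {S : Finset (SuperstarV k ℓ m)} (hS : GoodS i0 x0 S) :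
    (if cv ∈ S then - (r * qq i0 x0 p S) else if rv i0 x0 ∈ S then
        (1 - p) / 2 / ((ℓ : ℝ) * m) else 0)
      ≤ fit r S cv * ∑ v, outWeights (superstarOut k ℓ m) cv v *
        (ff hk i0 x0 β γ a p (nextS S cv v) - ff hk i0 x0 β γ a p S) := by
  have hq := qq_nonneg i0 x0 hp S
  by_cases hc : cv ∈ S
  · simp only [hc, fit, if_true]
    rw [← mul_neg]
    apply mul_le_mul_of_nonneg_left _ (by linarith)
    calc -qq i0 x0 p S = ∑ v, outWeights (superstarOut k ℓ m) cv v * (-qq i0 x0 p S) := by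
          rw [← Finset.sum_mul, outWeights_sum _ (out_nonempty hk i0 x0), one_mul]
      _ ≤ _ := by
          refine Finset.sum_le_sum fun v _ => ?_
          apply mul_le_mul_of_nonneg_left _ (outWeights_nonneg _ _ _)
          have h1 := ff_nonneg hk i0 x0 hβ hγ ha hp hphi (nextS S cv v)
          have h2 := ff_le_qq hk i0 x0 hβ hγ ha hp S
          linarith
  · simp only [hc, fit, if_false, nextS, one_mul]
    rw [outWeights_sum_mul, out_cv, Finset.sum_image (by intro x _ y _ h; simpa using h),
      Finset.card_image_of_injective _ Sum.inl_injective]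
    simp only [Finset.card_univ, Fintype.card_prod, Fintype.card_fin, Nat.cast_mul]
    have hz : ∀ x ∈ (Finset.univ : Finset (Fin ℓ × Fin m)), x ≠ (i0, x0) →
        ff hk i0 x0 β γ a p (S.erase (Sum.inl x)) - ff hk i0 x0 β γ a p S = 0 := by
      rintro ⟨i, x⟩ - hne
      have : (rv i x : SuperstarV k ℓ m) ∉ S := by
        intro h
        obtain ⟨h1, h2⟩ := hS.1 i x h
        exact hne (by rw [h1, h2])
      rw [Finset.erase_eq_of_notMem this, sub_self]
    rw [Finset.sum_eq_single (i0, x0) hz (by simp)]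
    by_cases hx : rv i0 x0 ∈ S
    · rw [if_pos hx]
      have hg := good_erase i0 x0 hS (rv i0 x0)
      have e2 : phi hk i0 β γ a (S.erase (rv i0 x0)) ≤ phi hk i0 β γ a S :=
        phi_erase hk i0 hβ hγ ha S _
      have e3 := phi_le hk i0 hβ hγ ha S
      have e4 : (1 - p) / 2 ≤ ff hk i0 x0 β γ a p (S.erase (rv i0 x0))
          - ff hk i0 x0 β γ a p S := by
        unfold ff
        rw [if_pos hg, if_pos hS]
        simp only [qq, hx, if_true, Finset.notMem_erase, if_false]
        nlinarith
      rw [div_eq_inv_mul ((1 - p) / 2)]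
      apply mul_le_mul_of_nonneg_left e4 (by positivity)
    · rw [if_neg hx, Finset.erase_eq_of_notMem hx, sub_self, mul_zero]

lemma drift_total (hk2 : 2 ≤ k) (hr : 1 < r) (hβ : 0 < β) (hγ : 0 < γ) (ha : 0 < a)
    (hp : 0 < p) (hp1 : p < 1)
    (hphi : β + γ * (a + k) ≤ 1 / 2)
    (hγe : γ = 2 * r * β) (hβl : 2 * r ≤ ((ℓ : ℝ) - 1) * β)
    (ham : r * k ≤ a * ((m : ℝ) - 1)) (hsm : γ * a < 1)
    (hpd : p * (r * (γ * a)) < (1 - p) / 2 / ((ℓ : ℝ) * m))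
    {S : Finset (SuperstarV k ℓ m)} (hS : GoodS i0 x0 S) (hne : S ≠ ∅) :
    0 < ∑ u, fit r S u * ∑ v, outWeights (superstarOut k ℓ m) u v *
        (ff hk i0 x0 β γ a p (nextS S u v) - ff hk i0 x0 β γ a p S) := by
  rw [Fintype.sum_sum_type, Fintype.sum_sum_type, Fintype.sum_unique (ι := Unit)]
  have hq := qq_nonneg i0 x0 hp S
  set q := qq i0 x0 p S with hqdef
  -- reservoirs
  have H1 : q * (((m : ℝ) - 1) * (if pv i0 ⟨0, hk⟩ ∈ S then γ * a else 0)
      - (if rv i0 x0 ∈ S then r * (γ * a) else 0)) ≤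
      ∑ u : Fin ℓ × Fin m, fit r S (Sum.inl u) *
        ∑ v, outWeights (superstarOut k ℓ m) (Sum.inl u) v *
        (ff hk i0 x0 β γ a p (nextS S (Sum.inl u) v) - ff hk i0 x0 β γ a p S) := by
    refine le_trans (le_of_eq ?_) (Finset.sum_le_sum fun u _ =>
      drift_rv hk i0 x0 hr hβ hγ ha hp hS u.1 u.2)
    rw [← Finset.mul_sum, Fintype.sum_prod_type]
    congr 1
    rw [Finset.sum_comm]
    simp only [Finset.sum_ite_eq', Finset.mem_univ, if_true, Finset.sum_add_distrib,
      Finset.sum_const, Finset.card_univ, Fintype.card_fin, nsmul_eq_mul]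
    ring
  obtain ⟨js, hjs⟩ := drift_pv_own hk i0 x0 hr hβ hγ ha hp hS
  have H2 : q * (((ℓ : ℝ) - 1) * (if cv ∈ S then β else 0)
        - (if pv i0 ⟨0, hk⟩ ∈ S then r * (γ * ((k : ℝ) - 1)) else 0)
        - (if pv i0 ⟨k - 1, by omega⟩ ∈ S then r * β else 0)
        + (if pv i0 ⟨0, hk⟩ ∉ S ∧ 0 < g2 i0 S then γ else 0)) ≤
      ∑ u : Fin ℓ × Fin k, fit r S (Sum.inr (Sum.inl u)) *
        ∑ v, outWeights (superstarOut k ℓ m) (Sum.inr (Sum.inl u)) v *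
        (ff hk i0 x0 β γ a p (nextS S (Sum.inr (Sum.inl u)) v) - ff hk i0 x0 β γ a p S) := by
    rw [Fintype.sum_prod_type, ← Finset.add_sum_erase _ _ (Finset.mem_univ i0)]
    have hA := Finset.sum_le_sum fun j (_ : j ∈ (Finset.univ : Finset (Fin k))) => hjs j
    rw [← Finset.mul_sum, Finset.sum_add_distrib, Finset.sum_sub_distrib,
      Finset.sum_neg_distrib] at hA
    simp only [Finset.sum_ite_eq', Finset.mem_univ, if_true] at hA
    have hB : ∀ i ∈ (Finset.univ : Finset (Fin ℓ)).erase i0,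
        q * (if cv ∈ S then β else 0) ≤ ∑ j : Fin k, fit r S (pv i j) *
        ∑ v, outWeights (superstarOut k ℓ m) (pv i j) v *
        (ff hk i0 x0 β γ a p (nextS S (pv i j) v) - ff hk i0 x0 β γ a p S) := by
      intro i hi
      refine le_trans (le_of_eq ?_) (Finset.sum_le_sum fun j _ =>
        drift_pv_other hk i0 x0 hr hβ hγ ha hp hS i (Finset.ne_of_mem_erase hi) j)
      rw [← Finset.mul_sum]
      simp only [Finset.sum_ite_eq', Finset.mem_univ, if_true]
      rfl
    have hB2 := Finset.sum_le_sum hB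
    rw [Finset.sum_const, Finset.card_erase_of_mem (Finset.mem_univ _), Finset.card_univ,
      Fintype.card_fin, nsmul_eq_mul, Nat.cast_sub (Fin.pos i0), Nat.cast_one] at hB2
    refine le_trans (le_of_eq ?_) (add_le_add hA hB2)
    rw [← hqdef]
    ring
  have H3 := drift_cv hk i0 x0 hr hβ hγ ha hp hp1 hphi hS
  rw [← hqdef] at H3
  refine lt_of_lt_of_le ?_ (add_le_add H1 (add_le_add H2 H3))
  have hl : pv i0 ⟨k - 1, by omega⟩ ∈ S → 0 < g2 i0 S := by
    intro h
    have := le_g2 i0 S ⟨k - 1, by omega⟩ (by simp only; omega) h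
    simp only at this
    omega
  -- path part
  set B0 : ℝ := ((m : ℝ) - 1) * (if pv i0 ⟨0, hk⟩ ∈ S then γ * a else 0)
    - (if pv i0 ⟨0, hk⟩ ∈ S then r * (γ * ((k : ℝ) - 1)) else 0)
    - (if pv i0 ⟨k - 1, by omega⟩ ∈ S then r * β else 0)
    + (if pv i0 ⟨0, hk⟩ ∉ S ∧ 0 < g2 i0 S then γ else 0) with hB0
  have hrβ : 0 < r * β := by positivity
  have hB0n : 0 ≤ B0 ∧ ((pv i0 ⟨0, hk⟩ ∈ S ∨ 0 < g2 i0 S) → 0 < B0) := by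
    have hlast : (if pv i0 ⟨k - 1, by omega⟩ ∈ S then r * β else 0) ≤ r * β := by
      split_ifs <;> linarith
    by_cases h0 : pv i0 ⟨0, hk⟩ ∈ S
    · have h1 : 0 < B0 := by
        rw [hB0, if_pos h0, if_pos h0,
          if_neg (show ¬(pv i0 ⟨0, hk⟩ ∉ S ∧ 0 < g2 i0 S) by tauto)]
        have := mul_le_mul_of_nonneg_left ham hγ.le
        have : γ < r * γ := by nlinarith
        nlinarith
      exact ⟨h1.le, fun _ => h1⟩
    · by_cases hg : 0 < g2 i0 S
      · have h1 : 0 < B0 := by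
          rw [hB0, if_neg h0, if_neg h0, 
            if_pos (show pv i0 ⟨0, hk⟩ ∉ S ∧ 0 < g2 i0 S from ⟨h0, hg⟩)]
          nlinarith
        exact ⟨h1.le, fun _ => h1⟩
      · have h1 : B0 = 0 := by
          rw [hB0, if_neg h0, if_neg h0, if_neg (by tauto), if_neg (by tauto)]
          simp
        exact ⟨h1.ge, fun h => absurd h (by tauto)⟩
  have key : 0 < q * B0 + (q * (((ℓ : ℝ) - 1) * (if cv ∈ S then β else 0)
      - (if rv i0 x0 ∈ S then r * (γ * a) else 0)) + (if cv ∈ S then - (r * q) else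
        if rv i0 x0 ∈ S then (1 - p) / 2 / ((ℓ : ℝ) * m) else 0)) := by
    have hqB := mul_nonneg hq.le hB0n.1
    have hra : r * (γ * a) < r := by nlinarith
    have hγa := mul_pos hγ ha
    by_cases hc : cv ∈ S
    · simp only [hc, if_true]
      have h1 : (if rv i0 x0 ∈ S then r * (γ * a) else 0) < r := by
        split_ifs <;> linarith
      have h2 : r < ((ℓ : ℝ) - 1) * β - (if rv i0 x0 ∈ S then r * (γ * a) else 0) := by linarith
      have := mul_lt_mul_of_pos_left h2 hq
      linarith
    · by_cases hx : rv i0 x0 ∈ S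
      · have hqp : q = p := by simp [hqdef, qq, hx]
        simp only [hc, hx, if_true, if_false]
        rw [hqp] at hqB ⊢
        linarith
      · simp only [hc, hx, if_false]
        have : pv i0 ⟨0, hk⟩ ∈ S ∨ 0 < g2 i0 S := by
          obtain ⟨u, hu⟩ := Finset.nonempty_iff_ne_empty.mpr hne
          rcases u with ⟨i, x⟩ | ⟨i, j⟩ | ⟨⟩
          · obtain ⟨rfl, rfl⟩ := hS.1 i x hu
            exact absurd hu hx
          · obtain rfl := hS.2 i j hu
            by_cases hj : (j : ℕ) = 0
            · left
              have : j = ⟨0, hk⟩ := Fin.ext hj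
              exact this ▸ hu
            · right
              have := le_g2 i S j (by omega) hu
              have := j.isLt
              omega
          · exact absurd hu hc
        have := mul_pos hq (hB0n.2 this)
        simpa using this
  rw [hB0] at key
  linarith

end params

end Superstar

/-- **Extinction lower bound for superstars, explicit constants** (Corollary 4.4).  For
every `r > 1` there is an `n₀` such that for all positive integers `k`, `ℓ`, `m` with
`n = ℓ(k+m)+1 ≥ n₀`, if `k ≥ (70/3)·r⁴·log n`, `ℓ ≥ 210·r⁴·k·log n` and `m ≥ 18·r²·k`,
then for every fixed initial mutant `x₀` lying in a reservoir, the discrete-time Moran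
process with fitness `r` on the `(k,ℓ,m)`-superstar started from `{x₀}` has extinction
probability at least `1/(1470·r⁴·k)`. -/
theorem superstar_extinction_explicit (r : ℝ) (hr : 1 < r) :
    ∃ n₀ : ℕ, ∀ k ℓ m : ℕ, 0 < k → 0 < ℓ → 0 < m →
      ∀ n : ℕ, n = ℓ * (k + m) + 1 → n₀ ≤ n →
        (70 / 3 : ℝ) * r ^ 4 * Real.log (n : ℝ) ≤ (k : ℝ) →
        210 * r ^ 4 * (k : ℝ) * Real.log (n : ℝ) ≤ (ℓ : ℝ) →
        18 * r ^ 2 * (k : ℝ) ≤ (m : ℝ) →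
        ∀ x₀ : SuperstarV k ℓ m, (∃ i x, x₀ = Sum.inl (i, x)) →
          1 / (1470 * r ^ 4 * (k : ℝ)) ≤
            extinctionProb r (outWeights (superstarOut k ℓ m)) (pointInit x₀) := by
  refine ⟨3, fun k ℓ m hk hℓ hm n hn hn0 hkl hll hml x hx => ?_⟩
  obtain ⟨i0, x0, rfl⟩ := hx
  have hlog : 1 ≤ Real.log (n : ℝ) := by
    rw [Real.le_log_iff_exp_le (by positivity)]
    have : (3 : ℝ) ≤ n := by exact_mod_cast hn0
    linarith [Real.exp_one_lt_d9]
  have hr2 : 1 < r ^ 2 := by nlinarith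
  have hr4 : r ^ 2 < r ^ 4 := by nlinarith
  have hk23 : (23 : ℝ) ≤ k := by nlinarith
  have hk2 : 2 ≤ k := by exact_mod_cast (by linarith : (2:ℝ) ≤ k)
  have hL : 210 * (r ^ 4 * k) ≤ (ℓ : ℝ) := by
    have : 0 < 210 * r ^ 4 * (k : ℝ) := by positivity
    nlinarith
  set K : ℝ := r ^ 2 * k with hK
  have hrk : r * k ≤ K := by rw [hK]; nlinarith
  have hK4 : K ≤ r ^ 4 * k := by rw [hK]; nlinarith
  have hrk0 : (k : ℝ) ≤ r * k := by nlinarith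
  have hL1 : (ℓ : ℝ) / 2 ≤ ℓ - 1 := by linarith
  have hM1 : (m : ℝ) / 2 ≤ m - 1 := by nlinarith
  have hMK : 18 * K ≤ m := by rw [hK]; linarith
  have hl0 : (0 : ℝ) < ℓ := by exact_mod_cast hℓ
  have hm0 : (0 : ℝ) < m := by exact_mod_cast hm
  -- parameters
  set β : ℝ := 4 * r / ℓ with hβ
  set γ : ℝ := 2 * r * β with hγ
  set a : ℝ := 2 * (r * k) / m with ha
  set p : ℝ := 1 / (1470 * r ^ 4 * (k : ℝ)) with hp
  have hβ0 : 0 < β := by positivity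
  have hγ0 : 0 < γ := by positivity
  have ha0 : 0 < a := by positivity
  have hp0 : 0 < p := by positivity
  have ha1 : a ≤ 1 := by rw [ha, div_le_one hm0]; linarith
  have hrp : r ^ 4 * k * p = 1 / 1470 := by rw [hp]; field_simp
  have h1r : 1 ≤ r ^ 4 * k := by linarith
  have hp1 : p ≤ 1 / 1470 := by
    have := mul_le_mul_of_nonneg_right h1r hp0.le
    linarith
  have hβK : β * (r * k) ≤ 4 / 210 := by
    rw [hβ, div_mul_eq_mul_div, div_le_iff₀ hl0]
    have : 4 * r * (r * k) = 4 * K := by rw [hK]; ring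
    linarith
  have hβr : β * r ≤ 1 / 210 := by
    have := mul_le_mul_of_nonneg_left hk23 (mul_pos hβ0 (by linarith : 0 < r)).le
    linarith
  have hβ1 : β ≤ 1 / 210 := by linarith [mul_le_mul_of_nonneg_left (show (1:ℝ) ≤ r from hr.le) hβ0.le, hβr]
  have hphi : β + γ * (a + k) ≤ 1 / 2 := by
    have : γ * a ≤ γ := mul_le_of_le_one_right hγ0.le ha1
    have : γ * k ≤ 8 / 210 := by rw [hγ]; linarith
    have : γ ≤ 2 / 210 := by rw [hγ]; linarith
    linarith
  have hβl : 2 * r ≤ ((ℓ : ℝ) - 1) * β := by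
    have : (ℓ : ℝ) / 2 * β = 2 * r := by rw [hβ]; field_simp; ring
    have h2 := mul_le_mul_of_nonneg_right hL1 hβ0.le
    linarith
  have ham : r * k ≤ a * ((m : ℝ) - 1) := by
    have : a * ((m : ℝ) / 2) = r * k := by rw [ha]; field_simp
    have h2 := mul_le_mul_of_nonneg_left hM1 ha0.le
    linarith
  have hsm : γ * a < 1 := by
    have : γ * a ≤ γ := mul_le_of_le_one_right hγ0.le ha1
    have : γ ≤ 2 / 210 := by rw [hγ]; linarith
    linarith
  have hpd : p * (r * (γ * a)) < (1 - p) / 2 / ((ℓ : ℝ) * m) := by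
    rw [lt_div_iff₀ (by positivity)]
    have : p * (r * (γ * a)) * ((ℓ : ℝ) * m) = 16 * (r ^ 4 * k * p) := by
      rw [hγ, ha, hβ]; field_simp; ring
    rw [this, hrp]
    linarith
  haveI : Nonempty (SuperstarV k ℓ m) := ⟨cv⟩
  have hmain := extinction_ge hr (outWeights (superstarOut k ℓ m))
    (outWeights_nonneg _) (outWeights_sum _ (out_nonempty hk i0 x0)) (rv i0 x0)
    (ff hk i0 x0 β γ a p) (ff_nonneg hk i0 x0 hβ0 hγ0 ha0 hp0 hphi)
    (fun S => (ff_le_qq hk i0 x0 hβ0 hγ0 ha0 hp0 S).trans (by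
      unfold qq; split_ifs <;> linarith))
    (fun S hS hf => drift_total hk i0 x0 hk2 hr hβ0 hγ0 ha0 hp0 (by linarith) hphi hγ hβl ham
      hsm hpd (by
        by_contra hg
        apply hf
        unfold ff
        rw [if_neg hg]) hS)
  refine le_trans (le_of_eq ?_) hmain
  have hg : GoodS i0 x0 ({rv i0 x0} : Finset (SuperstarV k ℓ m)) := by
    constructor
    · intro i x h; simpa using h
    · intro i j h; simp at h
  have hg2 : g2 i0 ({rv i0 x0} : Finset (SuperstarV k ℓ m)) = 0 := by
    unfold g2; simp
  unfold ff
  rw [if_pos hg]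
  simp [qq, phi, hg2]
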